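/- Let u : ℝ³ → ℝ³ be smooth with compact support and divergence free, let S = (1/2)(Du + Duᵀ) and ω = curl u. Then ∫_{ℝ³} [ tr(((u·∇)S) S) + (1/3) tr(S³) + (1/4) ⟨ω, S ω⟩ ] dx = 0, where (u·∇)S is the matrix field with entries Σ_k u_k ∂_k S_{ij}. Hence the term (u·∇)S + (1/3)S² + (1/4) ω⊗ω is L²-orthogonal to S. -/

import Mathlib

open Matrix MeasureTheory

/-- Partial derivative `∂ᵢ f` of a scalar field on `ℝ³`. -/
noncomputable def pd (i : Fin 3) (f : (Fin 3 → ℝ) → ℝ) (x : Fin 3 → ℝ) : ℝ :=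
  fderiv ℝ f x (Pi.single i 1)

/-- The Jacobian matrix of `u : ℝ³ → ℝ³`, with entries `(Du)ᵢⱼ = ∂ᵢuⱼ`. -/
noncomputable def jacobian (u : (Fin 3 → ℝ) → (Fin 3 → ℝ)) (x : Fin 3 → ℝ) :
    Matrix (Fin 3) (Fin 3) ℝ :=
  Matrix.of fun i j => pd i (fun y => u y j) x

/-- The strain matrix `∇_sym u = (1/2)(Du + Duᵀ)`. -/
noncomputable def strain (u : (Fin 3 → ℝ) → (Fin 3 → ℝ)) (x : Fin 3 → ℝ) :
    Matrix (Fin 3) (Fin 3) ℝ :=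
  (1 / 2 : ℝ) • (jacobian u x + (jacobian u x)ᵀ)

/-- The divergence `div u = Σᵢ ∂ᵢuᵢ`. -/
noncomputable def div3 (u : (Fin 3 → ℝ) → (Fin 3 → ℝ)) (x : Fin 3 → ℝ) : ℝ :=
  ∑ i, pd i (fun y => u y i) x

/-- The curl `curl u = (∂₂u₃−∂₃u₂, ∂₃u₁−∂₁u₃, ∂₁u₂−∂₂u₁)`. -/
noncomputable def curl3 (u : (Fin 3 → ℝ) → (Fin 3 → ℝ)) (x : Fin 3 → ℝ) : Fin 3 → ℝ :=
  ![pd 1 (fun y => u y 2) x - pd 2 (fun y => u y 1) x,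
    pd 2 (fun y => u y 0) x - pd 0 (fun y => u y 2) x,
    pd 0 (fun y => u y 1) x - pd 1 (fun y => u y 0) x]

/-- The advective derivative `(u·∇)S` of the strain, with entries `Σ_k u_k ∂_k S_{ij}`. -/
noncomputable def advectStrain (u : (Fin 3 → ℝ) → (Fin 3 → ℝ)) (x : Fin 3 → ℝ) :
    Matrix (Fin 3) (Fin 3) ℝ :=
  Matrix.of fun i j => ∑ k, u x k * pd k (fun y => strain u y i j) x

theorem pd_add {f g : (Fin 3 → ℝ) → ℝ} {x : Fin 3 → ℝ} (i : Fin 3)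
    (hf : DifferentiableAt ℝ f x) (hg : DifferentiableAt ℝ g x) :
    pd i (fun y => f y + g y) x = pd i f x + pd i g x := by
  simp [pd, fderiv_fun_add hf hg]

theorem pd_mul {f g : (Fin 3 → ℝ) → ℝ} {x : Fin 3 → ℝ} (i : Fin 3)
    (hf : DifferentiableAt ℝ f x) (hg : DifferentiableAt ℝ g x) :
    pd i (fun y => f y * g y) x = f x * pd i g x + g x * pd i f x := by
  simp [pd, fderiv_fun_mul hf hg]

theorem pd_const_mul {f : (Fin 3 → ℝ) → ℝ} {x : Fin 3 → ℝ} (i : Fin 3) (c : ℝ)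
    (hf : DifferentiableAt ℝ f x) :
    pd i (fun y => c * f y) x = c * pd i f x := by
  simp [pd, fderiv_const_mul hf]

theorem pd_sum {ι : Type*} (s : Finset ι) {f : ι → (Fin 3 → ℝ) → ℝ} {x : Fin 3 → ℝ} (i : Fin 3)
    (hf : ∀ a ∈ s, DifferentiableAt ℝ (f a) x) :
    pd i (fun y => ∑ a ∈ s, f a y) x = ∑ a ∈ s, pd i (f a) x := by
  simp [pd, fderiv_fun_sum hf]

theorem contDiff_pd {f : (Fin 3 → ℝ) → ℝ} (i : Fin 3) (hf : ContDiff ℝ (⊤ : ℕ∞) f) :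
    ContDiff ℝ (⊤ : ℕ∞) (pd i f) :=
  (hf.fderiv_right (by simp)).clm_apply contDiff_const

theorem pd_pd_apply {f : (Fin 3 → ℝ) → ℝ} (hf : ContDiff ℝ (⊤ : ℕ∞) f) (i j : Fin 3)
    (x : Fin 3 → ℝ) :
    pd i (pd j f) x = fderiv ℝ (fderiv ℝ f) x (Pi.single i 1) (Pi.single j 1) := by
  have hd : DifferentiableAt ℝ (fderiv ℝ f) x :=
    (hf.fderiv_right (m := (⊤ : ℕ∞)) (by simp)).differentiable (by simp) x
  change fderiv ℝ (fun y => fderiv ℝ f y (Pi.single j 1)) x (Pi.single i 1) = _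
  rw [fderiv_clm_apply hd (differentiableAt_const _)]
  simp

theorem pd_comm {f : (Fin 3 → ℝ) → ℝ} (hf : ContDiff ℝ (⊤ : ℕ∞) f) (i j : Fin 3)
    (x : Fin 3 → ℝ) : pd i (pd j f) x = pd j (pd i f) x := by
  rw [pd_pd_apply hf, pd_pd_apply hf]
  exact hf.contDiffAt.isSymmSndFDerivAt
    (by simpa using WithTop.coe_le_coe.2 (le_top (a := (2 : ℕ∞)))) _ _

theorem hasCompactSupport_pd {f : (Fin 3 → ℝ) → ℝ} (i : Fin 3) (hf : HasCompactSupport f) :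
    HasCompactSupport (pd i f) :=
  hf.fderiv_apply ℝ _

theorem integrable_pd {f : (Fin 3 → ℝ) → ℝ} (i : Fin 3) (hf : ContDiff ℝ (⊤ : ℕ∞) f)
    (hs : HasCompactSupport f) : Integrable (pd i f) :=
  (contDiff_pd i hf).continuous.integrable_of_hasCompactSupport (hasCompactSupport_pd i hs)

theorem integral_pd_eq_zero {f : (Fin 3 → ℝ) → ℝ} (i : Fin 3) (hf : ContDiff ℝ (⊤ : ℕ∞) f)
    (hs : HasCompactSupport f) : ∫ x, pd i f x = 0 := by
  have h := integral_mul_fderiv_eq_neg_fderiv_mul_of_integrable (μ := volume)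
    (f := fun _ : Fin 3 → ℝ => (1 : ℝ)) (g := f) (v := Pi.single i 1)
    (by simp) (by simpa [pd] using! integrable_pd i hf hs)
    (by simpa using hf.continuous.integrable_of_hasCompactSupport hs)
    (fun x _ => differentiableAt_const _) (fun x _ => hf.differentiable (by simp) x)
  simpa [pd] using h

/-- For divergence-free `u` with Jacobian `A`, the divergence of this field is
`⟨(u·∇)S, S⟩ + (1/3) tr A³`. -/
noncomputable def strainFlux (u : (Fin 3 → ℝ) → (Fin 3 → ℝ)) (i : Fin 3) (x : Fin 3 → ℝ) : ℝ :=
  ∑ j, ∑ k, (u x i * (jacobian u x j k * ((1 / 4 : ℝ) * jacobian u x j k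
      + (1 / 12 : ℝ) * jacobian u x k j))
    + (1 / 3 : ℝ) * (u x j * (jacobian u x j k * jacobian u x k i)))

theorem contDiff_component {u : (Fin 3 → ℝ) → (Fin 3 → ℝ)} (hu : ContDiff ℝ (⊤ : ℕ∞) u)
    (i : Fin 3) : ContDiff ℝ (⊤ : ℕ∞) (fun x => u x i) :=
  contDiff_pi.1 hu i

theorem contDiff_jacobian {u : (Fin 3 → ℝ) → (Fin 3 → ℝ)} (hu : ContDiff ℝ (⊤ : ℕ∞) u)
    (i j : Fin 3) : ContDiff ℝ (⊤ : ℕ∞) (fun x => jacobian u x i j) :=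
  contDiff_pd i (contDiff_component hu j)

theorem contDiff_strainFlux {u : (Fin 3 → ℝ) → (Fin 3 → ℝ)} (hu : ContDiff ℝ (⊤ : ℕ∞) u)
    (i : Fin 3) : ContDiff ℝ (⊤ : ℕ∞) (strainFlux u i) := by
  have h1 := contDiff_component hu
  have h2 := contDiff_jacobian hu
  unfold strainFlux
  fun_prop

theorem hasCompactSupport_strainFlux {u : (Fin 3 → ℝ) → (Fin 3 → ℝ)} (hs : HasCompactSupport u)
    (i : Fin 3) : HasCompactSupport (strainFlux u i) := by
  refine hs.mono fun x hx hux => hx ?_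
  simp [strainFlux, hux]

theorem pd_strainFlux {u : (Fin 3 → ℝ) → (Fin 3 → ℝ)} (hu : ContDiff ℝ (⊤ : ℕ∞) u)
    (i l : Fin 3) (x : Fin 3 → ℝ) :
    pd l (strainFlux u i) x =
      ∑ j, ∑ k, (u x i * (jacobian u x j k * ((1 / 4 : ℝ) * pd l (fun y => jacobian u y j k) x
            + (1 / 12 : ℝ) * pd l (fun y => jacobian u y k j) x)
          + ((1 / 4 : ℝ) * jacobian u x j k + (1 / 12 : ℝ) * jacobian u x k j)
            * pd l (fun y => jacobian u y j k) x)
        + jacobian u x j k * ((1 / 4 : ℝ) * jacobian u x j k + (1 / 12 : ℝ) * jacobian u x k j)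
          * jacobian u x l i
        + (1 / 3 : ℝ) * (u x j * (jacobian u x j k * pd l (fun y => jacobian u y k i) x
            + jacobian u x k i * pd l (fun y => jacobian u y j k) x)
          + jacobian u x j k * jacobian u x k i * jacobian u x l j)) := by
  have h1 (j : Fin 3) : DifferentiableAt ℝ (fun y => u y j) x :=
    (contDiff_component hu j).differentiable (by simp) x
  have h2 (j k : Fin 3) : DifferentiableAt ℝ (fun y => jacobian u y j k) x :=
    (contDiff_jacobian hu j k).differentiable (by simp) x
  have hpd (j k : Fin 3) : pd j (fun y => u y k) x = jacobian u x j k := rfl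
  unfold strainFlux
  rw [pd_sum _ _ fun j _ => by fun_prop]
  refine Finset.sum_congr rfl fun j _ => ?_
  rw [pd_sum _ _ fun k _ => by fun_prop]
  refine Finset.sum_congr rfl fun k _ => ?_
  rw [pd_add _ (by fun_prop) (by fun_prop), pd_mul _ (by fun_prop) (by fun_prop),
    pd_mul _ (by fun_prop) (by fun_prop), pd_add _ (by fun_prop) (by fun_prop),
    pd_const_mul _ _ (by fun_prop), pd_const_mul _ _ (by fun_prop),
    pd_const_mul _ _ (by fun_prop), pd_mul _ (by fun_prop) (by fun_prop),
    pd_mul _ (by fun_prop) (by fun_prop), hpd, hpd]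

theorem pd_strain {u : (Fin 3 → ℝ) → (Fin 3 → ℝ)} (hu : ContDiff ℝ (⊤ : ℕ∞) u)
    (l i j : Fin 3) (x : Fin 3 → ℝ) :
    pd l (fun y => strain u y i j) x =
      (1 / 2 : ℝ) * (pd l (fun y => jacobian u y i j) x + pd l (fun y => jacobian u y j i) x) := by
  have h2 (j k : Fin 3) : DifferentiableAt ℝ (fun y => jacobian u y j k) x :=
    (contDiff_jacobian hu j k).differentiable (by simp) x
  rw [← pd_add _ (h2 i j) (h2 j i), ← pd_const_mul _ _ (by fun_prop)]
  rfl

theorem pd_jacobian_trace {u : (Fin 3 → ℝ) → (Fin 3 → ℝ)} (hu : ContDiff ℝ (⊤ : ℕ∞) u)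
    (hdiv : ∀ x, div3 u x = 0) (l : Fin 3) (x : Fin 3 → ℝ) :
    ∑ j, pd l (fun y => jacobian u y j j) x = 0 := by
  rw [← pd_sum _ _ fun j _ => (contDiff_jacobian hu j j).differentiable (by simp) x]
  have h : (fun y => ∑ j, jacobian u y j j) = fun _ => 0 := funext hdiv
  simp [h, pd]

/-- The pointwise identity behind `dropped_term_orthogonal_to_strain`: the integrand is the
divergence of `strainFlux u`. -/
theorem integrand_eq_divergence_strainFlux {u : (Fin 3 → ℝ) → (Fin 3 → ℝ)}
    (hu : ContDiff ℝ (⊤ : ℕ∞) u) (hdiv : ∀ x, div3 u x = 0) (x : Fin 3 → ℝ) :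
    (advectStrain u x * strain u x).trace
        + (1 / 3 : ℝ) * ((strain u x) ^ 3).trace
        + (1 / 4 : ℝ) * ∑ i, ∑ j, strain u x i j * curl3 u x i * curl3 u x j
      = ∑ i, pd i (strainFlux u i) x := by
  have hcurl : curl3 u x = ![jacobian u x 1 2 - jacobian u x 2 1,
      jacobian u x 2 0 - jacobian u x 0 2, jacobian u x 0 1 - jacobian u x 1 0] := rfl
  have hS (i j : Fin 3) :
      strain u x i j = (1 / 2 : ℝ) * (jacobian u x i j + jacobian u x j i) := rfl
  have hT (i j : Fin 3) : advectStrain u x i j = ∑ k, u x k * ((1 / 2 : ℝ) *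
      (pd k (fun y => jacobian u y i j) x + pd k (fun y => jacobian u y j i) x)) := by
    simp only [advectStrain, of_apply, pd_strain hu]
  have htr : ∑ i, jacobian u x i i = 0 := hdiv x
  have htr' := fun l => pd_jacobian_trace hu hdiv l x
  have hcomm (k i j : Fin 3) :
      pd k (fun y => jacobian u y i j) x = pd i (fun y => jacobian u y k j) x :=
    pd_comm (contDiff_component hu j) k i x
  simp only [pd_strainFlux hu, Matrix.trace, Matrix.diag, pow_succ, pow_zero, one_mul,
    Matrix.mul_apply, hT, hS, hcurl]
  generalize jacobian u x = a at *
  generalize u x = v at *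
  generalize hb : (fun k i j => pd k (fun y => jacobian u y i j) x) = b
  have hb' (k i j : Fin 3) : pd k (fun y => jacobian u y i j) x = b k i j := by rw [← hb]
  simp only [hb'] at *
  simp only [Fin.sum_univ_three, Matrix.cons_val_zero, Matrix.cons_val_one,
    Matrix.cons_val] at *
  have ha : a 2 2 = -a 0 0 - a 1 1 := by linarith
  have h0 : b 0 2 2 = -b 0 0 0 - b 0 1 1 := by linarith [htr' 0]
  have h1 : b 1 2 2 = -b 0 1 0 - b 1 1 1 := by linarith [htr' 1, hcomm 1 0 0]
  have h2 : b 2 2 2 = -b 0 2 0 - b 1 2 1 := by linarith [htr' 2, hcomm 2 0 0, hcomm 2 1 1]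
  simp only [hcomm 1 0, hcomm 2 0, hcomm 2 1, ha, h0, h1, h2]
  ring

theorem dropped_term_orthogonal_to_strain
    (u : (Fin 3 → ℝ) → (Fin 3 → ℝ))
    (hsmooth : ContDiff ℝ (⊤ : ℕ∞) u) (hsupp : HasCompactSupport u)
    (hdiv : ∀ x, div3 u x = 0) :
    ∫ x : Fin 3 → ℝ,
        ((advectStrain u x * strain u x).trace
          + (1 / 3 : ℝ) * ((strain u x) ^ 3).trace
          + (1 / 4 : ℝ) * ∑ i, ∑ j, strain u x i j * curl3 u x i * curl3 u x j)
      = 0 := by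
  simp only [integrand_eq_divergence_strainFlux hsmooth hdiv]
  have hF := contDiff_strainFlux hsmooth
  have hc := hasCompactSupport_strainFlux hsupp
  rw [integral_finsetSum _ fun i _ => integrable_pd i (hF i) (hc i)]
  exact Finset.sum_eq_zero fun i _ => integral_pd_eq_zero i (hF i) (hc i)
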